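/- Let ρ = (w, G) be a weighted permutation representation that is not supersingular. Let m be the number of classes of the level set partition, and suppose m divides g and g/m is an odd prime number. If every value w(x) has odd denominator (i.e. w(X) ⊆ ℤ_(2)), then δ_ρ ∈ {m, g}. -/

import Mathlib

open scoped BigOperators

namespace PaperAux

/-- The symbol set `X_{2g}`, modeled as `Fin g ⊕ Fin g`. -/
abbrev X (g : ℕ) := Fin g ⊕ Fin g

/-- The complex conjugation involution `c`, swapping `i` and `ī`. -/
def conjPerm (g : ℕ) : Equiv.Perm (X g) := Equiv.sumComm (Fin g) (Fin g)

/-- The group `W_{2g}`: the centralizer of `c` in `Sym(X_{2g})`. -/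
def Wgrp (g : ℕ) : Subgroup (Equiv.Perm (X g)) := Subgroup.centralizer {conjPerm g}

/-- `w` is a weight function. -/
structure IsWeightFn (g : ℕ) (w : X g → ℚ) : Prop where
  nonneg : ∀ x, 0 ≤ w x
  add_one : ∀ i : Fin g, w (Sum.inl i) + w (Sum.inr i) = 1
  mono : ∀ i j : Fin g, i ≤ j → w (Sum.inl i) ≤ w (Sum.inl j)
  den_dvd : ∀ s : ℚ, s.den ∣ (Finset.univ.filter fun x => w x = s).card

/-- The map `Φ_ρ : X → MonoidAlgebra ℚ G`,
`Φ_ρ(x) = ∑_{σ ∈ G} w(σ⁻¹ x) • (σ : MonoidAlgebra ℚ G)`. -/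
noncomputable def Phi {g : ℕ} (w : X g → ℚ) (G : Subgroup (Equiv.Perm (X g))) (x : X g) :
    MonoidAlgebra ℚ G :=
  ∑ᶠ σ : G, w (((σ : Equiv.Perm (X g))⁻¹) x) • MonoidAlgebra.of ℚ G σ

/-- The sum `∑_{σ ∈ G} σ` in the group algebra. -/
noncomputable def allSum {g : ℕ} (G : Subgroup (Equiv.Perm (X g))) : MonoidAlgebra ℚ G :=
  ∑ᶠ σ : G, MonoidAlgebra.of ℚ G σ

/-- `ρ = (w, G)` is geometrically simple (with base point `x₀ = Sum.inl 0`):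
the stabilizer of `Φ_ρ(x₀)` under left multiplication equals the stabilizer of `x₀`. -/
def GeomSimple {g : ℕ} (w : X g → ℚ) (G : Subgroup (Equiv.Perm (X g))) (x₀ : X g) : Prop :=
  ∀ σ : G, MonoidAlgebra.of ℚ G σ * Phi w G x₀ = Phi w G x₀ ↔ (σ : Equiv.Perm (X g)) x₀ = x₀

/-- The exceptionality identity for a pair of disjoint subsets `T⁺, T⁻ ⊆ Fin g`. -/
def ExcId {g : ℕ} (w : X g → ℚ) (G : Subgroup (Equiv.Perm (X g)))
    (Tp Tm : Finset (Fin g)) : Prop :=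
  (∑ i ∈ Tp, Phi w G (Sum.inl i)) - (∑ j ∈ Tm, Phi w G (Sum.inl j))
    = (((Tp.card : ℚ) - (Tm.card : ℚ)) / 2) • allSum G

/-- `ρ = (w, G)` is exceptional. -/
def IsExceptional {g : ℕ} (w : X g → ℚ) (G : Subgroup (Equiv.Perm (X g))) : Prop :=
  ∃ Tp Tm : Finset (Fin g), Disjoint Tp Tm ∧ (Tp ∪ Tm).Nonempty ∧
    Even (Tp.card + Tm.card) ∧ ExcId w G Tp Tm

/-- The induced map `σ⁺ : Fin g → Fin g` of `σ ∈ W`. -/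
def plusFun {g : ℕ} (σ : Equiv.Perm (X g)) (i : Fin g) : Fin g :=
  Sum.elim id id (σ (Sum.inl i))

/-- The level set equivalence relation on `Fin g`. -/
def levelRel {g : ℕ} (G : Subgroup (Equiv.Perm (X g))) (i j : Fin g) : Prop :=
  ∀ γ ∈ G, (∀ k, plusFun γ k = k) →
    ((γ (Sum.inl i) = Sum.inr i) ↔ (γ (Sum.inl j) = Sum.inr j))

/-- The level set partition, as a setoid. -/
def levelSetoid {g : ℕ} (G : Subgroup (Equiv.Perm (X g))) : Setoid (Fin g) where
  r := levelRel G
  iseqv := ⟨fun _ _ _ _ => Iff.rfl,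
            fun h γ hγ h2 => (h γ hγ h2).symm,
            fun h1 h2 γ hγ h3 => (h1 γ hγ h3).trans (h2 γ hγ h3)⟩

/-- `m`: the number of classes of the level set partition. -/
noncomputable def numLevels {g : ℕ} (G : Subgroup (Equiv.Perm (X g))) : ℕ :=
  Nat.card (Quotient (levelSetoid G))

/-- The angle rank `δ_ρ` of a weighted permutation representation. -/
noncomputable def angleRank {g : ℕ} (w : X g → ℚ) (G : Subgroup (Equiv.Perm (X g))) : ℕ :=
  Module.finrank ℚ (Submodule.span ℚ (Set.range (Phi w G))) - 1

end PaperAux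

open PaperAux

namespace PaperAux

open Module Polynomial

theorem finrank_of_shift_invariant {p : ℕ} [hp : Fact p.Prime] (S : Submodule ℚ (ZMod p → ℚ))
    (hS : ∀ f ∈ S, (fun k => f (k + 1)) ∈ S) {b : ZMod p → ℚ} (hb : b ∈ S)
    (hsum : ∑ k, b k ≠ 0) :
    finrank ℚ S = 1 ∨ finrank ℚ S = p := by
  classical
  let L : Module.End ℚ (ZMod p → ℚ) := LinearMap.funLeft ℚ ℚ (fun k : ZMod p => k + 1)
  have L_pow (n : ℕ) (f : ZMod p → ℚ) : (L ^ n) f = fun k => f (k + n) := by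
    induction n generalizing f with
    | zero => simp
    | succ n ih =>
      rw [pow_succ, Module.End.mul_apply, ih]
      funext k
      simp [L, LinearMap.funLeft_apply, add_assoc]
  have L_mem (q : ℚ[X]) (f) (hf : f ∈ S) : aeval L q f ∈ S := by
    have pow_mem (n : ℕ) : (L ^ n) f ∈ S := by
      induction n with
      | zero => simpa
      | succ n ih =>
        rw [pow_succ', Module.End.mul_apply]
        exact hS _ ih
    rw [aeval_eq_sum_range, LinearMap.sum_apply]
    exact S.sum_mem fun i _ => S.smul_mem _ (pow_mem i)
  have sum_range (f : ZMod p → ℚ) : ∑ i ∈ Finset.range p, f i = ∑ k, f k := by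
    refine Finset.sum_nbij' (fun i => (i : ZMod p)) ZMod.val ?_ ?_ ?_ ?_ ?_
    · simp
    · intro k _; simpa using ZMod.val_lt k
    · intro i hi; exact ZMod.val_cast_of_lt (Finset.mem_range.1 hi)
    · simp
    · simp
  have aeval_cyclotomic (f : ZMod p → ℚ) :
      aeval L (cyclotomic p ℚ) f = fun _ => ∑ k, f k := by
    funext k
    simp only [cyclotomic_prime, map_sum, map_pow, aeval_X, LinearMap.sum_apply, L_pow,
      Finset.sum_apply]
    rw [sum_range fun i => f (k + i)]
    exact Equiv.sum_comp (Equiv.addLeft k) f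
  let d : ZMod p → ℚ := Pi.single 0 1
  have exists_poly (f : ZMod p → ℚ) : ∃ q : ℚ[X], aeval L q d = f := by
    refine ⟨∑ i ∈ Finset.range p, C (f (-i)) * Polynomial.X ^ i, ?_⟩
    funext k
    simp only [map_sum, map_mul, aeval_C, map_pow, aeval_X, LinearMap.sum_apply, L_pow,
      Finset.sum_apply, Module.End.mul_apply, Module.algebraMap_end_apply, Pi.smul_apply]
    rw [sum_range fun i => f (-i) • d (k + i), Finset.sum_eq_single (-k)]
    · simp [d]
    · intro i _ hi
      have : k + i ≠ 0 := fun h => hi (by linear_combination h)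
      simp [d, this]
    · simp
  have const_mem : (fun _ => 1 : ZMod p → ℚ) ∈ S := by
    have h := S.smul_mem (∑ k, b k)⁻¹ (L_mem (cyclotomic p ℚ) b hb)
    rw [aeval_cyclotomic] at h
    convert h using 1
    funext k
    simp [inv_mul_cancel₀ hsum]
  by_cases hconst : ∀ f ∈ S, ∀ k, f k = f 0
  · left
    have : S = Submodule.span ℚ {(fun _ => 1 : ZMod p → ℚ)} := by
      apply le_antisymm
      · intro f hf
        refine Submodule.mem_span_singleton.2 ⟨f 0, ?_⟩
        funext k
        simp [hconst f hf k]
      · simpa using const_mem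
    rw [this]
    exact finrank_span_singleton fun h => one_ne_zero (congrFun h 0)
  · right
    push Not at hconst
    obtain ⟨a, ha, k, hk⟩ := hconst
    obtain ⟨A, hA⟩ := exists_poly a
    have hirr : Irreducible (cyclotomic p ℚ) := cyclotomic.irreducible_rat hp.out.pos
    rcases EuclideanDomain.dvd_or_coprime _ A hirr with ⟨Q, rfl⟩ | hcop
    · rw [map_mul, Module.End.mul_apply, aeval_cyclotomic] at hA
      rw [← hA] at hk
      exact absurd rfl hk
    · obtain ⟨r, s, hrs⟩ := hcop
      have hd : d ∈ S := by
        have h := congrArg (fun q => aeval L q d) hrs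
        simp only [map_add, map_mul, LinearMap.add_apply, Module.End.mul_apply, map_one,
          Module.End.one_apply, hA, aeval_cyclotomic] at h
        rw [← h]
        refine S.add_mem (L_mem _ _ ?_) (L_mem _ _ ha)
        simpa [d] using const_mem
      have : S = ⊤ := by
        rw [eq_top_iff]
        intro f _
        obtain ⟨q, rfl⟩ := exists_poly f
        exact L_mem q d hd
      rw [this, finrank_top, finrank_fintype_fun_eq_card, ZMod.card]

theorem exists_iterate_eq_or_eq {α : Type*} [DecidableEq α] {p : ℕ} [Fact p.Prime] (hp : Odd p)
    {τ c : α → α} (hcomm : Function.Commute τ c) (hcc : ∀ x, c (c x) = x) (hc : ∀ x, c x ≠ x)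
    {B : Finset α} (hB : B.card = 2 * p) (hτB : ∀ y ∈ B, τ y ∈ B) (hcB : ∀ y ∈ B, c y ∈ B)
    {x : α} (hx : x ∈ B) (hper : τ^[p] x = x) (hne : τ x ≠ x) {y : α} (hy : y ∈ B) :
    ∃ k < p, y = τ^[k] x ∨ y = c (τ^[k] x) := by
  have hmin : Function.minimalPeriod τ x = p := Function.minimalPeriod_eq_prime hper hne
  have hinj : Set.InjOn (fun k => τ^[k] x) (Finset.range p : Set ℕ) := by
    have h := Function.iterate_injOn_Iio_minimalPeriod (f := τ) (x := x)
    rw [hmin] at h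
    simpa [Set.InjOn] using h
  have hcinj : Function.Injective c := Function.LeftInverse.injective hcc
  have hc_ne (j : ℕ) : c x ≠ τ^[j] x := by
    intro h
    have h2 : τ^[j + j] x = x := by
      rw [Function.iterate_add_apply, ← h, hcomm.iterate_left j x, ← h, hcc]
    have hdvd : p ∣ j + j := by
      rw [← hmin]
      exact Function.IsPeriodicPt.minimalPeriod_dvd h2
    have hdvd' : p ∣ j := by
      rw [← two_mul] at hdvd
      exact Nat.Coprime.dvd_of_dvd_mul_left (Nat.coprime_two_right.2 hp) hdvd
    have h3 : τ^[j] x = x := by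
      rw [← hmin] at hdvd'
      exact Function.isPeriodicPt_iff_minimalPeriod_dvd.2 hdvd'
    exact hc x (h.trans h3)
  let I := (Finset.range p).image fun k => τ^[k] x
  have hI : I.card = p := by
    rw [Finset.card_image_of_injOn hinj, Finset.card_range]
  have hdisj : Disjoint I (I.image c) := by
    rw [Finset.disjoint_left]
    intro z hz hz'
    simp only [I, Finset.mem_image, Finset.mem_range, exists_exists_and_eq_and] at hz hz'
    obtain ⟨l, hl, rfl⟩ := hz
    obtain ⟨k, hk, h⟩ := hz'
    apply hc_ne (p - k + l)
    have h' := congrArg (τ^[p - k]) h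
    rw [← hcomm.iterate_left k x, ← Function.iterate_add_apply, ← Function.iterate_add_apply,
      Nat.sub_add_cancel hk.le, hcomm.iterate_left p x, hper] at h'
    exact h'
  have hIB : I ∪ I.image c = B := by
    apply Finset.eq_of_subset_of_card_le
    · have hsub : I ⊆ B := by
        intro z hz
        simp only [I, Finset.mem_image, Finset.mem_range] at hz
        obtain ⟨k, -, rfl⟩ := hz
        clear hI hdisj
        induction k with
        | zero => simpa
        | succ k ih =>
          rw [Function.iterate_succ_apply']
          exact hτB _ ih
      refine Finset.union_subset hsub fun z hz => ?_
      obtain ⟨z, hzI, rfl⟩ := Finset.mem_image.1 hz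
      exact hcB _ (hsub hzI)
    · rw [Finset.card_union_of_disjoint hdisj, Finset.card_image_of_injective _ hcinj, hI, hB,
        two_mul]
  rw [← hIB] at hy
  simp only [I, Finset.mem_union, Finset.mem_image, Finset.mem_range,
    exists_exists_and_eq_and] at hy
  rcases hy with ⟨k, hk, rfl⟩ | ⟨k, hk, rfl⟩
  · exact ⟨k, hk, Or.inl rfl⟩
  · exact ⟨k, hk, Or.inr rfl⟩

theorem exists_mem_iterate_prime_eq {α : Type*} {p : ℕ} [Fact p.Prime]
    (G : Subgroup (Equiv.Perm α)) {B : Finset α} (hB : p ∣ B.card) (hne : B.Nonempty)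
    (htrans : ∀ x ∈ B, ∀ y ∈ B, ∃ σ ∈ G, σ x = y ∧ ∀ z, σ z ∈ B ↔ z ∈ B) :
    ∃ τ ∈ G, (∀ z ∈ B, τ z ∈ B) ∧ (∀ z ∈ B, τ^[p] z = z) ∧ ∃ x ∈ B, τ x ≠ x := by
  classical
  let K : Subgroup (Equiv.Perm B) :=
    { carrier := {k | ∃ σ ∈ G, ∀ b : B, (k b : α) = σ b}
      mul_mem' := by
        rintro k l ⟨σ, hσ, h⟩ ⟨ρ, hρ, h'⟩
        exact ⟨σ * ρ, G.mul_mem hσ hρ, fun b => by simp [h, h']⟩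
      one_mem' := ⟨1, G.one_mem, fun b => rfl⟩
      inv_mem' := by
        rintro k ⟨σ, hσ, h⟩
        refine ⟨σ⁻¹, G.inv_mem hσ, fun b => ?_⟩
        rw [Equiv.Perm.eq_inv_iff_eq, ← h]
        simp }
  have : MulAction.IsPretransitive K B := by
    refine ⟨fun x y => ?_⟩
    obtain ⟨σ, hσ, hxy, hσB⟩ := htrans x x.2 y y.2
    exact ⟨⟨σ.subtypePerm hσB, σ, hσ, fun b => rfl⟩, Subtype.ext hxy⟩
  obtain ⟨b, hb⟩ := hne
  have hdvd : p ∣ Nat.card K := by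
    refine hB.trans ?_
    have h := (MulAction.stabilizer K (⟨b, hb⟩ : B)).index_dvd_card
    rwa [MulAction.index_stabilizer_of_transitive, Nat.card_eq_fintype_card,
      Fintype.card_coe] at h
  obtain ⟨⟨k, τ, hτ, hk⟩, hord⟩ := exists_prime_orderOf_dvd_card' p hdvd
  replace hord : orderOf k = p := (Subgroup.orderOf_mk k _).symm.trans hord
  have hiter (n : ℕ) (z : B) : ((k ^ n) z : α) = τ^[n] z := by
    induction n with
    | zero => rfl
    | succ n ih => rw [pow_succ', Function.iterate_succ_apply', ← ih, ← hk]; rfl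
  refine ⟨τ, hτ, fun z hz => ?_, fun z hz => ?_, ?_⟩
  · rw [← hk ⟨z, hz⟩]
    exact (k _).2
  · rw [← hiter p ⟨z, hz⟩, ← hord, pow_orderOf_eq_one]
    rfl
  · by_contra! h
    have : k = 1 := by
      ext z
      rw [hk, h z z.2]
      rfl
    rw [this, orderOf_one] at hord
    exact (Fact.out : p.Prime).one_lt.ne hord

section Blocks

variable {α : Type*}

/-- Points lie in the same block when every element of `G` that acts on each orbit of `c` as `1`
or as `c` does so with the same sign at both points. -/
def blockSetoid (G : Subgroup (Equiv.Perm α)) (c : Equiv.Perm α) : Setoid α where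
  r x y := ∀ γ ∈ G, (∀ z, γ z = z ∨ γ z = c z) → (γ x = x ↔ γ y = y)
  iseqv := ⟨fun _ _ _ _ => Iff.rfl, fun h γ hγ h' => (h γ hγ h').symm,
    fun h₁ h₂ γ hγ h' => (h₁ γ hγ h').trans (h₂ γ hγ h')⟩

/-- The span of the `G`-translates of `u`. -/
def translates (G : Subgroup (Equiv.Perm α)) (u : α → ℚ) : Submodule ℚ (α → ℚ) :=
  Submodule.span ℚ (Set.range fun σ : G => fun x => u ((σ : Equiv.Perm α)⁻¹ x))

/-- Restriction of functions to a block, extended by zero. -/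
noncomputable def blockProj (s : Setoid α) (q : Quotient s) : (α → ℚ) →ₗ[ℚ] (α → ℚ) where
  toFun f := Set.indicator {x | Quotient.mk s x = q} f
  map_add' f h := Set.indicator_add _ f h
  map_smul' a f := Set.indicator_const_smul _ a f

variable {G : Subgroup (Equiv.Perm α)} {c : Equiv.Perm α} {u : α → ℚ}

theorem mem_translates_self : u ∈ translates G u :=
  Submodule.subset_span ⟨1, by simp⟩

theorem comp_mem_translates {σ : Equiv.Perm α} (hσ : σ ∈ G) {f : α → ℚ}
    (hf : f ∈ translates G u) : f ∘ σ ∈ translates G u := by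
  have h : translates G u ≤ (translates G u).comap (LinearMap.funLeft ℚ ℚ σ) := by
    rw [translates, Submodule.span_le]
    rintro _ ⟨ρ, rfl⟩
    refine Submodule.subset_span ⟨⟨σ, hσ⟩⁻¹ * ρ, ?_⟩
    funext x
    simp [LinearMap.funLeft_apply]
  exact h hf

theorem apply_eq_neg_of_mem_translates (hcomm : ∀ σ ∈ G, ∀ x, σ (c x) = c (σ x))
    (hu : ∀ x, u (c x) = -u x) {f : α → ℚ} (hf : f ∈ translates G u) (x : α) :
    f (c x) = -f x := by
  induction hf using Submodule.span_induction with
  | mem f h =>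
    obtain ⟨σ, rfl⟩ := h
    simp only
    rw [hcomm _ (G.inv_mem σ.2), hu]
  | zero => simp
  | add f h _ _ hf hh => simp [hf, hh, add_comm]
  | smul a f _ hf => simp [hf]

theorem blockRel_apply_iff (hcomm : ∀ σ ∈ G, ∀ x, σ (c x) = c (σ x)) {σ : Equiv.Perm α}
    (hσ : σ ∈ G) (x y : α) : blockSetoid G c (σ x) (σ y) ↔ blockSetoid G c x y := by
  have key {ρ : Equiv.Perm α} (hρ : ρ ∈ G) {x y : α} (h : blockSetoid G c x y) :
      blockSetoid G c (ρ x) (ρ y) := by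
    intro γ hγ hz
    have := h (ρ⁻¹ * γ * ρ) (G.mul_mem (G.mul_mem (G.inv_mem hρ) hγ) hρ) fun z => by
      simp only [Equiv.Perm.mul_apply, Equiv.Perm.inv_eq_iff_eq]
      rw [hcomm ρ hρ]
      exact hz (ρ z)
    simpa only [Equiv.Perm.mul_apply, Equiv.Perm.inv_eq_iff_eq] using this
  refine ⟨fun h => ?_, key hσ⟩
  simpa using key (G.inv_mem hσ) h

theorem blockRel_conj (hcomm : ∀ σ ∈ G, ∀ x, σ (c x) = c (σ x)) (x : α) :
    blockSetoid G c (c x) x := by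
  intro γ hγ _
  rw [hcomm γ hγ, c.injective.eq_iff]

theorem blockProj_mem_translates [Finite α] (hcomm : ∀ σ ∈ G, ∀ x, σ (c x) = c (σ x))
    (hc : ∀ x, c x ≠ x) (hu : ∀ x, u (c x) = -u x) (q : Quotient (blockSetoid G c))
    {f : α → ℚ} (hf : f ∈ translates G u) :
    blockProj (blockSetoid G c) q f ∈ translates G u := by
  classical
  have := Fintype.ofFinite α
  obtain ⟨x, rfl⟩ := Quotient.exists_rep q
  have factor (y : α) : ∃ t : α → ℚ, (∀ f ∈ translates G u, t * f ∈ translates G u) ∧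
      (∀ z, blockSetoid G c z x → t z = 1) ∧ (¬ blockSetoid G c y x → t y = 0) := by
    by_cases hyx : blockSetoid G c y x
    · exact ⟨1, by simp, by simp, by simp [hyx]⟩
    have hyx' := hyx
    change ¬ ∀ γ ∈ G, (∀ z, γ z = z ∨ γ z = c z) → (γ y = y ↔ γ x = x) at hyx'
    push Not at hyx'
    obtain ⟨γ, hγ, hz, hxy⟩ := hyx'
    let s : α → ℚ := fun z => if γ z = z then 1 else -1
    have hs (f) (hf : f ∈ translates G u) : s * f = f ∘ γ := by
      funext z
      by_cases h : γ z = z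
      · simp [s, h]
      · simp [s, (hz z).resolve_left h, apply_eq_neg_of_mem_translates hcomm hu hf, hc]
    refine ⟨fun z => (1 + s x * s z) / 2, fun f hf => ?_, fun z hzx => ?_, fun _ => ?_⟩
    · have : (fun z => (1 + s x * s z) / 2) * f = (1 / 2 : ℚ) • f + (s x / 2) • (s * f) := by
        funext z
        simp
        ring
      rw [this, hs f hf]
      exact add_mem (Submodule.smul_mem _ _ hf)
        (Submodule.smul_mem _ _ (comp_mem_translates hγ hf))
    · have : γ z = z ↔ γ x = x := hzx γ hγ hz
      by_cases h : γ x = x <;> simp [s, this, h]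
    · by_cases h : γ x = x
      · have : γ y ≠ y := by grind
        simp [s, this, h]
      · have : γ y = y := by grind
        simp [s, this, h]
  choose t ht h_one h_zero using factor
  have hprod (T : Finset α) (f) (hf : f ∈ translates G u) :
      (∏ y ∈ T, t y) * f ∈ translates G u := by
    induction T using Finset.induction_on with
    | empty => simpa
    | insert y T hy ih =>
      rw [Finset.prod_insert hy, mul_assoc]
      exact ht y _ ih
  convert hprod Finset.univ f hf using 1
  funext z
  simp only [blockProj, LinearMap.coe_mk, AddHom.coe_mk, Set.indicator_apply, Set.mem_ofPred_eq,
    Quotient.eq, Pi.mul_apply, Finset.prod_apply]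
  split_ifs with h
  · rw [Finset.prod_eq_one fun y _ => h_one y z h, one_mul]
  · rw [Finset.prod_eq_zero (f := fun y => t y z) (Finset.mem_univ z) (h_zero z h), zero_mul]

theorem blockProj_apply (s : Setoid α) (q : Quotient s) (f : α → ℚ) (x : α)
    [Decidable (Quotient.mk s x = q)] :
    blockProj s q f x = if Quotient.mk s x = q then f x else 0 := by
  simp only [blockProj, LinearMap.coe_mk, AddHom.coe_mk, Set.indicator_apply, Set.mem_ofPred_eq]

theorem map_blockProj_translates_le [Finite α] (hcomm : ∀ σ ∈ G, ∀ x, σ (c x) = c (σ x))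
    (hc : ∀ x, c x ≠ x) (hu : ∀ x, u (c x) = -u x) (q : Quotient (blockSetoid G c)) :
    (translates G u).map (blockProj _ q) ≤ translates G u := by
  rintro _ ⟨f, hf, rfl⟩
  exact blockProj_mem_translates hcomm hc hu q hf

theorem finrank_translates_eq_sum [Finite α] [Fintype (Quotient (blockSetoid G c))]
    (hcomm : ∀ σ ∈ G, ∀ x, σ (c x) = c (σ x))
    (hc : ∀ x, c x ≠ x) (hu : ∀ x, u (c x) = -u x) :
    finrank ℚ (translates G u) = ∑ q : Quotient (blockSetoid G c),
      finrank ℚ ((translates G u).map (blockProj _ q)) := by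
  classical
  rw [← finrank_pi_fintype]
  let F : translates G u →ₗ[ℚ] ∀ q : Quotient (blockSetoid G c),
      (translates G u).map (blockProj _ q) :=
    LinearMap.pi fun q => (blockProj _ q).submoduleMap (translates G u)
  refine LinearEquiv.finrank_eq (LinearEquiv.ofBijective F ⟨fun f h hfh => ?_, fun v => ?_⟩)
  · ext x
    have := congrArg (fun v => (v (Quotient.mk _ x) : α → ℚ) x) hfh
    simpa [F, blockProj_apply] using this
  · refine ⟨∑ q, ⟨v q, map_blockProj_translates_le hcomm hc hu q (v q).2⟩, ?_⟩
    have hv (q : Quotient (blockSetoid G c)) (x : α) (h : Quotient.mk _ x ≠ q) :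
        (v q : α → ℚ) x = 0 := by
      obtain ⟨f, -, hf⟩ := (v q).2
      rw [← hf, blockProj_apply, if_neg h]
    ext q x
    simp only [F, LinearMap.pi_apply, LinearMap.submoduleMap_coe_apply, blockProj_apply,
      AddSubmonoidClass.coe_finsetSum, Finset.sum_apply]
    split_ifs with h
    · refine Finset.sum_eq_single_of_mem q (Finset.mem_univ q) fun q' _ hq' => hv q' x ?_
      rw [h]
      exact hq'.symm
    · exact (hv q x h).symm

theorem finrank_map_blockProj_eq (hcomm : ∀ σ ∈ G, ∀ x, σ (c x) = c (σ x))
    (htrans : ∀ x y, ∃ σ ∈ G, σ x = y) (q q' : Quotient (blockSetoid G c)) :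
    finrank ℚ ((translates G u).map (blockProj _ q)) =
      finrank ℚ ((translates G u).map (blockProj _ q')) := by
  classical
  obtain ⟨x, rfl⟩ := Quotient.exists_rep q
  obtain ⟨x', rfl⟩ := Quotient.exists_rep q'
  obtain ⟨σ, hσ, rfl⟩ := htrans x x'
  let D : (α → ℚ) ≃ₗ[ℚ] (α → ℚ) := LinearEquiv.funCongrLeft ℚ ℚ σ
  have hD : (translates G u).map (D : (α → ℚ) →ₗ[ℚ] (α → ℚ)) = translates G u := by
    apply le_antisymm
    · rintro _ ⟨f, hf, rfl⟩
      exact comp_mem_translates hσ hf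
    · intro f hf
      refine ⟨f ∘ (σ⁻¹ : Equiv.Perm α), comp_mem_translates (G.inv_mem hσ) hf, ?_⟩
      funext y
      simp [D, LinearEquiv.funCongrLeft_apply, LinearMap.funLeft_apply]
  have hcomp : blockProj (blockSetoid G c) (Quotient.mk _ x) ∘ₗ (D : (α → ℚ) →ₗ[ℚ] (α → ℚ)) =
      (D : (α → ℚ) →ₗ[ℚ] (α → ℚ)) ∘ₗ
        blockProj (blockSetoid G c) (Quotient.mk _ (σ x)) := by
    refine LinearMap.ext fun f => funext fun y => ?_
    simp [D, LinearEquiv.funCongrLeft_apply, LinearMap.funLeft_apply, blockProj_apply,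
      Quotient.eq, blockRel_apply_iff hcomm hσ]
  rw [← LinearEquiv.finrank_map_eq D ((translates G u).map (blockProj _ (Quotient.mk _ (σ x)))),
    ← Submodule.map_comp]
  conv_lhs => rw [← hD, ← Submodule.map_comp]
  rw [hcomp]

theorem card_block_eq [Fintype α] [DecidableEq (Quotient (blockSetoid G c))]
    (hcomm : ∀ σ ∈ G, ∀ x, σ (c x) = c (σ x))
    (htrans : ∀ x y, ∃ σ ∈ G, σ x = y) (q q' : Quotient (blockSetoid G c)) :
    (Finset.univ.filter fun x => Quotient.mk (blockSetoid G c) x = q).card =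
      (Finset.univ.filter fun x => Quotient.mk (blockSetoid G c) x = q').card := by
  obtain ⟨x, rfl⟩ := Quotient.exists_rep q
  obtain ⟨x', rfl⟩ := Quotient.exists_rep q'
  obtain ⟨σ, hσ, rfl⟩ := htrans x x'
  refine Finset.card_equiv σ fun y => ?_
  simp only [Finset.mem_filter_univ, Quotient.eq, blockRel_apply_iff hcomm hσ]

theorem finrank_map_blockProj [Fintype α] [DecidableEq (Quotient (blockSetoid G c))] {p : ℕ}
    [Fact p.Prime] (hp : Odd p) (hcomm : ∀ σ ∈ G, ∀ x, σ (c x) = c (σ x))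
    (hcc : ∀ x, c (c x) = x) (hc : ∀ x, c x ≠ x) (hu : ∀ x, u (c x) = -u x)
    (htrans : ∀ x y, ∃ σ ∈ G, σ x = y) (hsum : ∀ x : ZMod p → α, ∑ k, u (x k) ≠ 0)
    (q : Quotient (blockSetoid G c))
    (hq : (Finset.univ.filter fun x => Quotient.mk (blockSetoid G c) x = q).card = 2 * p) :
    finrank ℚ ((translates G u).map (blockProj _ q)) = 1 ∨
      finrank ℚ ((translates G u).map (blockProj _ q)) = p := by
  classical
  set B := Finset.univ.filter fun x => Quotient.mk (blockSetoid G c) x = q with hBdef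
  have mem_B (x : α) : x ∈ B ↔ Quotient.mk (blockSetoid G c) x = q := by simp [hBdef]
  have hstab {σ : Equiv.Perm α} (hσ : σ ∈ G) {x : α} (hx : x ∈ B) (hσx : σ x ∈ B) (z : α) :
      σ z ∈ B ↔ z ∈ B := by
    rw [mem_B] at hx hσx
    rw [mem_B, mem_B]
    nth_rewrite 1 [← hσx]
    rw [← hx, Quotient.eq, Quotient.eq, blockRel_apply_iff hcomm hσ]
  have hp0 : 0 < p := (Fact.out : p.Prime).pos
  obtain ⟨τ, hτ, hτB, hτp, x, hx, hne⟩ := exists_mem_iterate_prime_eq (p := p) G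
    (B := B) (hq ▸ Dvd.intro_left 2 rfl) (Finset.card_pos.1 (by lia)) fun x hx y hy => by
      obtain ⟨σ, hσ, rfl⟩ := htrans x y
      exact ⟨σ, hσ, rfl, hstab hσ hx hy⟩
  have hcB (y : α) (hy : y ∈ B) : c y ∈ B := by
    rw [mem_B] at hy ⊢
    rw [← hy, Quotient.eq]
    exact blockRel_conj hcomm y
  have hcover {y : α} (hy : y ∈ B) : ∃ k < p, y = τ^[k] x ∨ y = c (τ^[k] x) :=
    exists_iterate_eq_or_eq hp (hcomm τ hτ) hcc hc hq hτB hcB hx (hτp x hx) hne hy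
  have hiter (n : ℕ) : τ^[n] x ∈ B := by
    induction n with
    | zero => simpa
    | succ n ih =>
      rw [Function.iterate_succ_apply']
      exact hτB _ ih
  let E : (α → ℚ) →ₗ[ℚ] (ZMod p → ℚ) := LinearMap.funLeft ℚ ℚ fun k => τ^[k.val] x
  let M := (translates G u).map (blockProj _ q)
  have E_inj : Function.Injective (E.domRestrict M) := by
    rw [injective_iff_map_eq_zero]
    rintro ⟨f, hf⟩ hE
    have hodd := apply_eq_neg_of_mem_translates hcomm hu
      (map_blockProj_translates_le hcomm hc hu q hf)
    have h0 (k : ℕ) (hk : k < p) : f (τ^[k] x) = 0 := by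
      have := congrFun hE (k : ZMod p)
      simpa [E, LinearMap.funLeft_apply, ZMod.val_cast_of_lt hk] using this
    ext y
    by_cases hy : y ∈ B
    · obtain ⟨k, hk, rfl | rfl⟩ := hcover hy
      · exact h0 k hk
      · simp [hodd, h0 k hk]
    · obtain ⟨f, -, rfl⟩ := hf
      rw [mem_B] at hy
      simp [blockProj_apply, hy]
  have hM : finrank ℚ (M.map E) = finrank ℚ M := by
    rw [← LinearMap.range_domRestrict, LinearMap.finrank_range_of_inj E_inj]
  change finrank ℚ M = 1 ∨ finrank ℚ M = p
  rw [← hM]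
  refine finrank_of_shift_invariant (M.map E) ?_ (b := E (blockProj _ q u))
    ⟨_, ⟨u, mem_translates_self, rfl⟩, rfl⟩ ?_
  · rintro _ ⟨_, ⟨f, hf, rfl⟩, rfl⟩
    refine ⟨_, ⟨f ∘ τ, comp_mem_translates hτ hf, rfl⟩, ?_⟩
    funext k
    have hk : τ^[(k + 1).val] x = τ^[k.val + 1] x := by
      rw [ZMod.val_add, ZMod.val_one]
      exact Function.IsPeriodicPt.iterate_mod_apply (hτp x hx) _
    simp only [E, LinearMap.funLeft_apply, blockProj_apply, hk, if_pos ((mem_B _).1 (hiter _)),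
      Function.comp_apply, ← Function.iterate_succ_apply']
  · simp only [E, LinearMap.funLeft_apply, blockProj_apply, if_pos ((mem_B _).1 (hiter _))]
    exact hsum _

theorem finrank_translates [Fintype α] {p : ℕ}
    [Fact p.Prime] (hp : Odd p) (hcomm : ∀ σ ∈ G, ∀ x, σ (c x) = c (σ x))
    (hcc : ∀ x, c (c x) = x) (hc : ∀ x, c x ≠ x) (hu : ∀ x, u (c x) = -u x)
    (htrans : ∀ x y, ∃ σ ∈ G, σ x = y) (hsum : ∀ x : ZMod p → α, ∑ k, u (x k) ≠ 0)
    (hcard : Fintype.card α = 2 * (Nat.card (Quotient (blockSetoid G c)) * p)) :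
    finrank ℚ (translates G u) = Nat.card (Quotient (blockSetoid G c)) ∨
      finrank ℚ (translates G u) = Nat.card (Quotient (blockSetoid G c)) * p := by
  classical
  rw [Nat.card_eq_fintype_card] at hcard ⊢
  rw [finrank_translates_eq_sum hcomm hc hu]
  cases isEmpty_or_nonempty (Quotient (blockSetoid G c)) with
  | inl _ => simp
  | inr h =>
    obtain ⟨q⟩ := h
    rw [Finset.sum_congr rfl fun q' _ => finrank_map_blockProj_eq hcomm htrans q' q]
    have hq : (Finset.univ.filter fun x => Quotient.mk (blockSetoid G c) x = q).card = 2 * p := by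
      have h := Finset.card_eq_sum_card_fiberwise (s := Finset.univ) (t := Finset.univ)
        (f := Quotient.mk (blockSetoid G c)) (by simp)
      rw [Finset.sum_congr rfl fun q' _ => card_block_eq hcomm htrans q' q, Finset.sum_const,
        Finset.card_univ, Finset.card_univ, hcard, smul_eq_mul] at h
      have hpos : 0 < Fintype.card (Quotient (blockSetoid G c)) := Fintype.card_pos_iff.2 ⟨q⟩
      apply Nat.eq_of_mul_eq_mul_left hpos
      rw [← h]
      ring
    rcases finrank_map_blockProj hp hcomm hcc hc hu htrans hsum q hq with h | h <;> simp [h]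

end Blocks

theorem odd_den_sum {ι : Type*} (s : Finset ι) (f : ι → ℚ) (hf : ∀ i, Odd (f i).den) :
    Odd (∑ i ∈ s, f i).den := by
  classical
  induction s using Finset.induction_on with
  | empty => simp
  | insert i s hi ih =>
    rw [Finset.sum_insert hi]
    exact ((hf i).mul ih).of_dvd_nat (Rat.add_den_dvd _ _)

theorem sum_sub_half_ne_zero {ι : Type*} [Fintype ι] (hι : Odd (Fintype.card ι)) (f : ι → ℚ)
    (hf : ∀ i, Odd (f i).den) : ∑ i, (f i - 1 / 2) ≠ 0 := by
  intro h
  rw [Finset.sum_sub_distrib, Finset.sum_const, Finset.card_univ, nsmul_eq_mul, sub_eq_zero] at h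
  have hodd := odd_den_sum Finset.univ f hf
  set s := ∑ i, f i
  have h2 : (2 * s.num : ℚ) = (Fintype.card ι : ℚ) * s.den := by
    have := Rat.mul_den_eq_num s
    rw [← this]
    linear_combination (2 * s.den : ℚ) * h
  have h3 : 2 * s.num = (Fintype.card ι * s.den : ℕ) := by
    push_cast
    exact_mod_cast h2
  obtain ⟨r, hr⟩ := hι.mul hodd
  rw [hr] at h3
  lia

section AngleRank

variable {g : ℕ} {w : X g → ℚ} {G : Subgroup (Equiv.Perm (X g))}

theorem coeff_Phi (x : X g) (σ : G) :
    (Phi w G x).coeff σ = w ((σ : Equiv.Perm (X g))⁻¹ x) := by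
  classical
  have := Fintype.ofFinite G
  rw [Phi, finsum_eq_sum_of_fintype]
  simp [MonoidAlgebra.coeff_sum, Finsupp.single_apply, MonoidAlgebra.of_apply]

theorem finrank_span_Phi : finrank ℚ (Submodule.span ℚ (Set.range (Phi w G))) =
    finrank ℚ (translates G w) := by
  have := Fintype.ofFinite G
  let e : MonoidAlgebra ℚ G ≃ₗ[ℚ] (G → ℚ) :=
    (MonoidAlgebra.coeffLinearEquiv ℚ).trans (Finsupp.linearEquivFunOnFinite ℚ ℚ G)
  let A : Matrix (X g) G ℚ := Matrix.of fun x σ => w ((σ : Equiv.Perm (X g))⁻¹ x)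
  rw [← LinearEquiv.finrank_map_eq e, Submodule.map_span, ← Set.range_comp]
  have h : (e : MonoidAlgebra ℚ G →ₗ[ℚ] (G → ℚ)) ∘ Phi w G = A.row := by
    funext x σ
    exact coeff_Phi x σ
  rw [h, ← Matrix.rank_eq_finrank_span_row, Matrix.rank_eq_finrank_span_cols]
  rfl

theorem finrank_translates_sub_half (hc : conjPerm g ∈ G) (hg : 0 < g)
    (hcomm : ∀ σ ∈ G, ∀ x, σ (conjPerm g x) = conjPerm g (σ x))
    (hw : ∀ x, w (conjPerm g x) = 1 - w x) :
    finrank ℚ (translates G w) = finrank ℚ (translates G fun x => w x - 1 / 2) + 1 := by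
  set u : X g → ℚ := fun x => w x - 1 / 2 with hu_def
  let one : X g → ℚ := fun _ => 1
  have hu (x : X g) : u (conjPerm g x) = -u x := by
    simp only [hu_def, hw]
    ring
  have hone : one ∈ translates G w := by
    convert add_mem (mem_translates_self (G := G) (u := w))
      (comp_mem_translates hc (mem_translates_self (G := G) (u := w))) using 1
    funext x
    simp [one, hw]
  have hsup : translates G w = translates G u ⊔ Submodule.span ℚ {one} := by
    apply le_antisymm
    · rw [translates, Submodule.span_le]
      rintro _ ⟨σ, rfl⟩
      refine Submodule.mem_sup.2 ⟨fun x => u ((σ : Equiv.Perm (X g))⁻¹ x),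
        Submodule.subset_span ⟨σ, rfl⟩, (1 / 2 : ℚ) • one,
        Submodule.smul_mem _ _ (Submodule.mem_span_singleton_self one), ?_⟩
      funext x
      simp [u, one]
    · refine sup_le ?_ (by simpa using hone)
      rw [translates, Submodule.span_le]
      rintro _ ⟨σ, rfl⟩
      have : (fun x => u ((σ : Equiv.Perm (X g))⁻¹ x)) =
          (fun x => w ((σ : Equiv.Perm (X g))⁻¹ x)) - (1 / 2 : ℚ) • one := by
        funext x
        simp [u, one]
      change (fun x => u ((σ : Equiv.Perm (X g))⁻¹ x)) ∈ translates G w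
      rw [this]
      exact sub_mem (Submodule.subset_span ⟨σ, rfl⟩) (Submodule.smul_mem _ _ hone)
  have hinf : translates G u ⊓ Submodule.span ℚ {one} = ⊥ := by
    rw [eq_bot_iff]
    rintro _ ⟨hf, hf'⟩
    obtain ⟨a, rfl⟩ := Submodule.mem_span_singleton.1 hf'
    have h := apply_eq_neg_of_mem_translates hcomm hu hf (Sum.inl ⟨0, hg⟩)
    simp only [one, Pi.smul_apply, smul_eq_mul, mul_one] at h
    have ha : a = 0 := by linarith
    simp [ha]
  have h := Submodule.finrank_sup_add_finrank_inf_eq (translates G u) (Submodule.span ℚ {one})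
  have hone0 : one ≠ 0 := fun h => one_ne_zero (congrFun h (Sum.inl ⟨0, hg⟩))
  rwa [hinf, finrank_bot, add_zero, ← hsup, finrank_span_singleton hone0] at h

theorem numLevels_eq_card_quotient
    (hcomm : ∀ σ ∈ G, ∀ x, σ (conjPerm g x) = conjPerm g (σ x)) :
    numLevels G = Nat.card (Quotient (blockSetoid G (conjPerm g))) := by
  have hker (γ : Equiv.Perm (X g)) (hγ : γ ∈ G) :
      (∀ k, plusFun γ k = k) ↔ ∀ z, γ z = z ∨ γ z = conjPerm g z := by
    constructor
    · intro h
      have hl (k : Fin g) : γ (Sum.inl k) = Sum.inl k ∨ γ (Sum.inl k) = Sum.inr k := by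
        have hk := h k
        unfold plusFun at hk
        rcases hγk : γ (Sum.inl k) with j | j <;> simp_all
      rintro (k | k)
      · exact hl k
      · have hk : γ (Sum.inr k) = conjPerm g (γ (Sum.inl k)) := hcomm γ hγ (Sum.inl k)
        rw [hk]
        rcases hl k with h | h <;> rw [h] <;> simp [conjPerm]
    · intro h k
      unfold plusFun
      rcases h (Sum.inl k) with h | h <;> rw [h] <;> simp [conjPerm]
  have hrel (i j : Fin g) : levelSetoid G i j ↔
      blockSetoid G (conjPerm g) (Sum.inl i) (Sum.inl j) := by
    refine forall₂_congr fun γ hγ => ?_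
    rw [hker γ hγ]
    refine forall_congr' fun hz => ?_
    have (k : Fin g) : γ (Sum.inl k) = Sum.inr k ↔ ¬ γ (Sum.inl k) = Sum.inl k := by
      rcases hz (Sum.inl k) with h | h <;> rw [h] <;> simp [conjPerm]
    rw [this, this, not_iff_not]
  refine Nat.card_eq_of_bijective
    (Quotient.map' (s₁ := levelSetoid G) (s₂ := blockSetoid G (conjPerm g)) Sum.inl
      fun i j h => (hrel i j).1 h) ⟨?_, ?_⟩
  · rintro ⟨i⟩ ⟨j⟩ h
    exact Quotient.sound ((hrel i j).2 (Quotient.exact h))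
  · rintro ⟨i | i⟩
    · exact ⟨Quotient.mk _ i, rfl⟩
    · refine ⟨Quotient.mk _ i, Quotient.sound ?_⟩
      exact Setoid.symm' _ (blockRel_conj hcomm (Sum.inl i))

end AngleRank

end PaperAux

/-- if moreover every weight has odd denominator, then `δ_ρ ∈ {m, g}`. -/
theorem angleRank_eq_of_odd_denoms {g : ℕ} (w : X g → ℚ) (hw : IsWeightFn g w)
    (G : Subgroup (Equiv.Perm (X g))) (hGW : G ≤ Wgrp g) (hc : conjPerm g ∈ G)
    (htrans : ∀ x y : X g, ∃ σ ∈ G, σ x = y)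
    (hss : ¬ (∀ x : X g, w x = 1/2))
    (hdvd : numLevels G ∣ g) (hprime : Nat.Prime (g / numLevels G))
    (hodd : Odd (g / numLevels G))
    (hden : ∀ x : X g, Odd (w x).den) :
    angleRank w G = numLevels G ∨ angleRank w G = g := by
  have hcomm : ∀ σ ∈ G, ∀ x, σ (conjPerm g x) = conjPerm g (σ x) := fun σ hσ x =>
    (Equiv.ext_iff.1 (Subgroup.mem_centralizer_iff.1 (hGW hσ) _ rfl) x).symm
  have hw' (x : X g) : w (conjPerm g x) = 1 - w x := by
    rcases x with i | i <;> simp only [conjPerm, Equiv.sumComm_apply, Sum.swap_inl, Sum.swap_inr] <;>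
      linarith [hw.add_one i]
  have hg : 0 < g := by
    rcases Nat.eq_zero_or_pos g with rfl | h
    · simp [Nat.not_prime_zero] at hprime
    · exact h
  have hmul := Nat.mul_div_cancel' hdvd
  have := Fact.mk hprime
  rw [angleRank, finrank_span_Phi, finrank_translates_sub_half hc hg hcomm hw', Nat.add_sub_cancel]
  have hnum := numLevels_eq_card_quotient hcomm
  have key := finrank_translates (G := G) (c := conjPerm g) (u := fun x => w x - 1 / 2) hodd hcomm
    (fun x => by cases x <;> rfl) (fun x => by cases x <;> simp [conjPerm])
    (fun x => by simp only [hw']; ring) htrans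
    (fun x => sum_sub_half_ne_zero (by rwa [ZMod.card]) _ fun k => hden _)
    (by rw [← hnum, hmul]; simp [two_mul])
  rwa [← hnum, hmul] at key
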